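/- arXiv:2404.09306 — 2 statements merged into one kernel-verified Lean document; each statement's English description precedes it below -/
import Mathlib

section
/- There exists K > 0 (one may take K = 2) such that if for each n the random vector (n₁,…,n_n) has the multinomial distribution with n trials and all cell probabilities equal to 1/n, then P( max over 1 ≤ j ≤ n of n_j > K·(log n)/(log log n) ) → 0 as n → ∞. -/
open Filter Set
open scoped Classical

noncomputable section

/-- The number of indices `i` with `ξ i = j`: realizing a multinomial vector with `n`
trials and equal cell probabilities `1/n` as the cell counts of `n` i.i.d. uniform
draws `ξ` from `{1,…,n}`. -/
def multCount (n : ℕ) (ξ : Fin n → Fin n) (j : Fin n) : ℕ :=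
  (Finset.univ.filter fun i => ξ i = j).card

/-- Exponential moment of a cell count. -/
lemma sum_pow_multCount (n : ℕ) (j : Fin n) (t : ℝ) :
    ∑ ξ : Fin n → Fin n, t ^ multCount n ξ j = ((n : ℝ) - 1 + t) ^ n := by
  have h1 : ∀ ξ : Fin n → Fin n,
      t ^ multCount n ξ j = ∏ i : Fin n, (if ξ i = j then t else 1) := by
    intro ξ
    rw [Finset.prod_ite]
    simp [multCount]
  have h2 : ∑ k : Fin n, (if k = j then t else (1 : ℝ)) = (n : ℝ) - 1 + t := by
    have h : ∀ k : Fin n, (if k = j then t else (1 : ℝ)) = 1 + (if k = j then t - 1 else 0) := by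
      intro k
      split_ifs <;> ring
    simp_rw [h]
    rw [Finset.sum_add_distrib]
    simp
    ring
  simp_rw [h1]
  have h3 := Finset.prod_univ_sum (fun _ : Fin n => (Finset.univ : Finset (Fin n)))
    (fun _ k => if k = j then t else (1 : ℝ))
  rw [Fintype.piFinset_univ] at h3
  rw [← h3, Finset.prod_const, h2]
  simp

/-- Chernoff bound for one cell. -/
lemma card_cell_bound (n : ℕ) (hn : 0 < n) (j : Fin n) (hL : 1 < Real.log n) :
    (((Finset.univ.filter fun ξ : Fin n → Fin n =>
      3 * Real.log n / Real.log (Real.log n) < (multCount n ξ j : ℝ)).card : ℝ)) * (n : ℝ) ^ 3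
      ≤ (n : ℝ) ^ n * n := by
  have hn' : (0 : ℝ) < n := by exact_mod_cast hn
  have hn1 : (1 : ℝ) ≤ n := by exact_mod_cast hn
  set L := Real.log n with hLdef
  have hL0 : 0 < L := by linarith
  have hLL : 0 < Real.log L := Real.log_pos hL
  have hexp : Real.exp L = n := Real.exp_log hn'
  have hup : ((n : ℝ) - 1 + L) ^ n ≤ (n : ℝ) ^ n * n := by
    have h1 : (n : ℝ) - 1 + L ≤ n * Real.exp (L / n) := by
      have := Real.add_one_le_exp (L / n)
      calc (n : ℝ) - 1 + L ≤ n * (L / n + 1) := by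
            rw [mul_add, mul_div_cancel₀ _ hn'.ne']; linarith
        _ ≤ _ := by gcongr
    calc ((n : ℝ) - 1 + L) ^ n ≤ (n * Real.exp (L / n)) ^ n :=
          pow_le_pow_left₀ (by linarith) h1 n
      _ = (n : ℝ) ^ n * n := by
          rw [mul_pow, ← Real.exp_nat_mul, mul_div_cancel₀ _ hn'.ne', hexp]
  refine le_trans ?_ hup
  rw [← sum_pow_multCount n j L, ← nsmul_eq_mul, ← Finset.sum_const]
  refine le_trans (Finset.sum_le_sum ?_) (Finset.sum_le_sum_of_subset_of_nonneg
    (Finset.filter_subset _ _) (fun ξ _ _ => pow_nonneg hL0.le _))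
  intro ξ hξ
  have hξ' := (Finset.mem_filter.mp hξ).2
  rw [div_lt_iff₀ hLL] at hξ'
  calc (n : ℝ) ^ 3 = Real.exp (3 * L) := by
        rw [← hexp, ← Real.exp_nat_mul]; norm_num
    _ ≤ Real.exp (multCount n ξ j * Real.log L) := Real.exp_le_exp.mpr hξ'.le
    _ = L ^ multCount n ξ j := by rw [Real.exp_nat_mul, Real.exp_log hL0]

/-- **Maximum cell count of a uniform multinomial vector** (Lemma A.6). There exists
`K > 0` (one may take `K = 2`) such that, if `(n₁,…,nₙ)` is multinomial with `n`
trials and equal cell probabilities `1/n`, the probability that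
`max_j n_j > K log n / log log n` tends to `0` as `n → ∞`. The probability is written
as the proportion of uniform draws `ξ : Fin n → Fin n` whose maximal cell count
exceeds the threshold. -/
theorem multinomial_max_cell_count :
    ∃ K > (0 : ℝ),
      Tendsto (fun n : ℕ =>
        (((Finset.univ.filter fun ξ : Fin n → Fin n =>
            ∃ j : Fin n,
              K * Real.log n / Real.log (Real.log n) < (multCount n ξ j : ℝ)).card : ℝ) /
          (n : ℝ) ^ n))
        atTop (nhds 0) := by
  refine ⟨3, by norm_num, ?_⟩
  have hlog : Tendsto (fun n : ℕ => Real.log n) atTop atTop :=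
    Real.tendsto_log_atTop.comp tendsto_natCast_atTop_atTop
  refine squeeze_zero' (Eventually.of_forall fun n => by positivity) ?_
    (tendsto_one_div_atTop_nhds_zero_nat (𝕜 := ℝ))
  filter_upwards [hlog.eventually_gt_atTop 1, eventually_gt_atTop 0] with n hL hn
  have hn' : (0 : ℝ) < n := by exact_mod_cast hn
  rw [div_le_div_iff₀ (by positivity) hn', one_mul]
  have hunion : (((Finset.univ.filter fun ξ : Fin n → Fin n =>
            ∃ j : Fin n,
              3 * Real.log n / Real.log (Real.log n) < (multCount n ξ j : ℝ)).card : ℝ)) ≤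
      ∑ j : Fin n, (((Finset.univ.filter fun ξ : Fin n → Fin n =>
        3 * Real.log n / Real.log (Real.log n) < (multCount n ξ j : ℝ)).card : ℝ)) := by
    rw [← Nat.cast_sum]
    refine Nat.cast_le.mpr (le_trans (Finset.card_le_card ?_) Finset.card_biUnion_le)
    intro ξ hξ
    simpa using hξ
  have hsum := Finset.sum_le_sum (fun (j : Fin n) (_ : j ∈ Finset.univ) =>
    card_cell_bound n hn j hL)
  rw [← Finset.sum_mul, Finset.sum_const, Finset.card_univ, Fintype.card_fin, nsmul_eq_mul] at hsum
  have h := (mul_le_mul_of_nonneg_right hunion (by positivity : (0 : ℝ) ≤ (n : ℝ) ^ 3)).trans hsum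
  have h2 : (0 : ℝ) < (n : ℝ) ^ 2 := by positivity
  refine le_of_mul_le_mul_right ?_ h2
  linarith [h]
end
end

section
/- Let r > 3/2 and C > 0, and let μ be a probability measure on ℝ with a density f (with respect to Lebesgue measure) satisfying f(t) ≤ C·(1+t²)^{−r} for all t ∈ ℝ. Then, with F the cumulative distribution function of μ, ∫_ℝ √(F(t)·(1 − F(t))) dt ≤ 2 + 2·∫_1^∞ √(C·t^{1−2r}/(2r−1)) dt < ∞; in particular there is a finite bound depending only on C and r. -/
open MeasureTheory Set
open scoped ENNReal

noncomputable section


lemma aux_bound (r C s : ℝ) (hr : 3 / 2 < r) (hC : 0 < C) (hs : 0 < s) :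
    C * (1 + s ^ 2) ^ (-r) ≤ C * s ^ (-2 * r) := by
  have h1 : s ^ (-2 * r) = (s ^ 2) ^ (-r) := by
    rw [← Real.rpow_natCast s 2, ← Real.rpow_mul hs.le]
    congr 1
    push_cast
    ring
  rw [h1]
  apply mul_le_mul_of_nonneg_left _ hC.le
  exact Real.rpow_le_rpow_of_nonpos (by positivity) (by linarith) (by linarith)

lemma aux_tail (r C t : ℝ) (hr : 3 / 2 < r) (hC : 0 < C) (ht : 0 < t) (g : ℝ → ℝ)
    (hg : ∀ s : ℝ, g s ≤ C * (1 + s ^ 2) ^ (-r)) :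
    ∫⁻ s in Ioi t, ENNReal.ofReal (g s) ≤
      ENNReal.ofReal (C * t ^ (1 - 2 * r) / (2 * r - 1)) := by
  have hI : IntegrableOn (fun s : ℝ => C * s ^ (-2 * r)) (Ioi t) :=
    (integrableOn_Ioi_rpow_of_lt (by linarith) ht).const_mul C
  have hv : ∫ s in Ioi t, C * s ^ (-2 * r) = C * t ^ (1 - 2 * r) / (2 * r - 1) := by
    rw [integral_const_mul, integral_Ioi_rpow_of_lt (by linarith) ht]
    have e : -2 * r + 1 = 1 - 2 * r := by ring
    have e2 : 2 * r - 1 = - (1 - 2 * r) := by ring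
    rw [e, e2, div_neg, neg_div, mul_neg, mul_div_assoc]
  rw [← hv, ofReal_integral_eq_lintegral_ofReal hI]
  · apply setLIntegral_mono' measurableSet_Ioi
    intro s hs
    exact ENNReal.ofReal_le_ofReal ((hg s).trans (aux_bound r C s hr hC (ht.trans hs)))
  · filter_upwards [self_mem_ae_restrict measurableSet_Ioi] with s hs
    have : 0 < s := ht.trans hs
    positivity

/-- **Finite `∫ √(F(1-F))` for polynomially-dominated densities** (proof of Lemma
A.4). If `μ` is a probability measure on `ℝ` with density `f ≤ C (1+t²)^{-r}` for
some `r > 3/2`, then, with `F` the cdf of `μ`, the function `t ↦ √(F(t)(1-F(t)))` is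
integrable and `∫ √(F(1-F)) dt ≤ 2 + 2 ∫₁^∞ √(C t^{1-2r}/(2r-1)) dt`, a finite bound
depending only on `C` and `r`. -/
theorem sqrt_F_one_sub_F_integral_bound
    (r C : ℝ) (hr : 3 / 2 < r) (hC : 0 < C)
    (μ : Measure ℝ) (hμ : IsProbabilityMeasure μ)
    (f : ℝ → ℝ) (hfmeas : Measurable f) (hfnonneg : ∀ t, 0 ≤ f t)
    (hdens : μ = volume.withDensity fun t => ENNReal.ofReal (f t))
    (hfbound : ∀ t : ℝ, f t ≤ C * (1 + t ^ 2) ^ (-r)) :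
    Integrable (fun t : ℝ =>
      Real.sqrt ((μ (Iic t)).toReal * (1 - (μ (Iic t)).toReal))) volume ∧
    ∫ t : ℝ, Real.sqrt ((μ (Iic t)).toReal * (1 - (μ (Iic t)).toReal)) ≤
      2 + 2 * ∫ t in Ioi (1 : ℝ), Real.sqrt (C * t ^ (1 - 2 * r) / (2 * r - 1)) := by
  set h : ℝ → ℝ := fun t => Real.sqrt (C * t ^ (1 - 2 * r) / (2 * r - 1)) with hh
  set F : ℝ → ℝ := fun t => (μ (Iic t)).toReal with hF
  have hF0 : ∀ t, 0 ≤ F t := fun t => ENNReal.toReal_nonneg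
  have hF1 : ∀ t, F t ≤ 1 := fun t => by
    simpa using ENNReal.toReal_mono ENNReal.one_ne_top (prob_le_one (μ := μ) (s := Iic t))
  have hpos : ∀ t : ℝ, 0 < t → 0 ≤ C * t ^ (1 - 2 * r) / (2 * r - 1) := fun t ht => by
    have : 0 < 2 * r - 1 := by linarith
    positivity
  have hup : ∀ t, 0 < t → 1 - F t ≤ C * t ^ (1 - 2 * r) / (2 * r - 1) := by
    intro t ht
    have e : 1 - F t = (μ (Ioi t)).toReal := by
      have := probReal_compl_eq_one_sub (μ := μ) (s := Iic t) measurableSet_Iic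
      rw [compl_Iic] at this
      exact this.symm
    rw [e]
    apply ENNReal.toReal_le_of_le_ofReal (hpos t ht)
    rw [hdens, withDensity_apply _ measurableSet_Ioi]
    exact aux_tail r C t hr hC ht f hfbound
  have hlo : ∀ t, 0 < t → F (-t) ≤ C * t ^ (1 - 2 * r) / (2 * r - 1) := by
    intro t ht
    apply ENNReal.toReal_le_of_le_ofReal (hpos t ht)
    rw [hdens, withDensity_apply _ measurableSet_Iic]
    have := aux_tail r C t hr hC ht (fun s => f (-s)) (fun s => by simpa using hfbound (-s))
    refine le_trans (le_of_eq ?_) this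
    have e := (Measure.measurePreserving_neg (volume : Measure ℝ)).setLIntegral_comp_preimage
      (s := Iic (-t)) (f := fun s => ENNReal.ofReal (f s)) measurableSet_Iic (by fun_prop)
    rw [← e]
    have e3 : (Neg.neg ⁻¹' Iic (-t) : Set ℝ) = Ici t := by
      ext x; simp
    rw [e3]
    exact (setLIntegral_congr Ioi_ae_eq_Ici).symm
  have hmeasF : Measurable F := by
    apply Monotone.measurable
    intro a b hab
    exact ENNReal.toReal_mono (measure_ne_top _ _) (measure_mono (Iic_subset_Iic.2 hab))
  have hhI : IntegrableOn h (Ioi 1) := by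
    have hI : IntegrableOn (fun s : ℝ => Real.sqrt (C / (2 * r - 1)) * s ^ ((1 - 2 * r) / 2)) (Ioi 1) :=
      (integrableOn_Ioi_rpow_of_lt (by linarith) one_pos).const_mul _
    refine hI.congr_fun ?_ measurableSet_Ioi
    intro s hs
    have hs0 : (0 : ℝ) < s := lt_trans one_pos hs
    have : 0 < 2 * r - 1 := by linarith
    simp only [hh]
    rw [mul_div_right_comm, Real.sqrt_mul (by positivity), Real.sqrt_eq_rpow (s ^ _),
      ← Real.rpow_mul hs0.le]
    congr 2
    ring
  set H : ℝ → ℝ := (Ioi 1).indicator h with hH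
  have hHI : Integrable H := hhI.integrable_indicator measurableSet_Ioi
  have hH0 : ∀ t, 0 ≤ H t := fun t => indicator_nonneg (fun _ _ => Real.sqrt_nonneg _) t
  set K : ℝ → ℝ := (Icc (-1) 1).indicator (fun _ => 1) with hK
  have hK0 : ∀ t, 0 ≤ K t := fun t => indicator_nonneg (fun _ _ => zero_le_one) t
  have hKI : Integrable K :=
    (integrableOn_const (by simp)).integrable_indicator measurableSet_Icc
  have hGI : Integrable (fun t => K t + (H t + H (-t))) :=
    hKI.add (hHI.add hHI.comp_neg)
  have hle : ∀ t, Real.sqrt (F t * (1 - F t)) ≤ K t + (H t + H (-t)) := by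
    intro t
    have a0 := hF0 t
    have a1 := hF1 t
    have k0 := hK0 t
    have b0 := hH0 t
    have c0 := hH0 (-t)
    rcases lt_or_ge 1 t with h1 | h1
    · have e : H t = h t := indicator_of_mem (mem_Ioi.2 h1) _
      have : Real.sqrt (F t * (1 - F t)) ≤ h t :=
        Real.sqrt_le_sqrt (le_trans (by nlinarith) (hup t (by linarith)))
      linarith
    rcases lt_or_ge t (-1) with h2 | h2
    · have e : H (-t) = h (-t) := indicator_of_mem (mem_Ioi.2 (by linarith)) _
      have hl := hlo (-t) (by linarith)
      rw [neg_neg] at hl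
      have : Real.sqrt (F t * (1 - F t)) ≤ h (-t) :=
        Real.sqrt_le_sqrt (le_trans (by nlinarith) hl)
      linarith
    · have e : K t = 1 := indicator_of_mem (mem_Icc.2 ⟨h2, h1⟩) _
      have : Real.sqrt (F t * (1 - F t)) ≤ 1 := Real.sqrt_le_one.2 (by nlinarith)
      linarith
  have hgI : Integrable (fun t => Real.sqrt (F t * (1 - F t))) := by
    refine hGI.mono' (by fun_prop) (Filter.Eventually.of_forall fun t => ?_)
    rw [Real.norm_of_nonneg (Real.sqrt_nonneg _)]
    exact hle t
  refine ⟨hgI, (integral_mono hgI hGI hle).trans (le_of_eq ?_)⟩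
  have hHH : Integrable (fun t => H t + H (-t)) := hHI.add hHI.comp_neg
  rw [integral_add hKI hHH, integral_add hHI hHI.comp_neg,
    integral_neg_eq_self H, hK, hH, integral_indicator measurableSet_Icc,
    integral_indicator measurableSet_Ioi]
  simp
  norm_num
  ring
end
end
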